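/- arXiv:2304.10584 — 4 statements merged into one kernel-verified Lean document; each statement's English description precedes it below -/
import Mathlib

section
/- Let k be a field, n ∈ ℕ, and let V be an isotropic subspace of (k^{2n}, ω_n) of dimension r. Then there exists a linear symplectomorphism U of (k^{2n}, ω_n) (a linear automorphism with ω_n(U v, U w) = ω_n(v,w) for all v,w) such that U(V) is the subspace spanned by the rows of a block matrix of the form [I_r 0 | A B], where A is a symmetric r × r matrix and B is an r × (n−r) matrix over k. -/
open Matrix

/-- The block matrix `J_n = [[0, I_n], [−I_n, 0]]`. -/
def Jmat (k : Type*) [Field k] (n : ℕ) :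
    Matrix (Fin n ⊕ Fin n) (Fin n ⊕ Fin n) k :=
  Matrix.fromBlocks 0 1 (-1) 0

/-- The standard symplectic form on `k^{2n}`, `ω_n(v,w) = v J_n wᵀ`. -/
def stdSymplecticForm {k : Type*} [Field k] (n : ℕ)
    (v w : Fin n ⊕ Fin n → k) : k :=
  v ⬝ᵥ (Jmat k n).mulVec w

/-- The symplectic complement of a set `S` with respect to a form `ω`. -/
def sympComplSet {k X : Type*} [Zero k] (ω : X → X → k) (S : Set X) : Set X :=
  {x | ∀ u ∈ S, ω x u = 0}

/-- A submodule is isotropic when it is contained in its symplectic complement. -/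
def IsIsotropic {k X : Type*} [Field k] [AddCommGroup X] [Module k X]
    (ω : X → X → k) (U : Submodule k X) : Prop :=
  (U : Set X) ⊆ sympComplSet ω (U : Set X)

/-- The `r × 2n` block matrix `[I_r 0 | A B]`, where `A` is `r × r` and `B` is
`r × (n − r)`: its Z-block is `[I_r 0]` and its X-block is `[A B]`. -/
def blockIAB {k : Type*} [Field k] {r n : ℕ}
    (A : Matrix (Fin r) (Fin r) k) (B : Matrix (Fin r) (Fin (n - r)) k) :
    Matrix (Fin r) (Fin n ⊕ Fin n) k :=
  Matrix.of fun i => Sum.elim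
    (fun j => if (j : ℕ) = (i : ℕ) then 1 else 0)
    (fun j => if h : (j : ℕ) < r then A i ⟨(j : ℕ), h⟩
      else B i ⟨(j : ℕ) - r, by have := j.isLt; omega⟩)

section SymplecticBasis

open LinearMap Module

variable {k E : Type*} [Field k] [AddCommGroup E] [Module k E] [FiniteDimensional k E]

/-- A linearly independent family of length `r < n` with isotropic span in a nondegenerate
alternating space of dimension `2n` can be prolonged by one vector. -/
theorem exists_isotropic_snoc {B : LinearMap.BilinForm k E} (hB : B.Nondegenerate)
    (hA : B.IsAlt) {n r : ℕ} (hE : finrank k E = 2 * n) (hr : r < n) (v : Fin r → E)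
    (hv : LinearIndependent k v) (hiso : ∀ i j, B (v i) (v j) = 0) :
    ∃ x : E, LinearIndependent k (Fin.snoc v x : Fin (r + 1) → E) ∧
      ∀ i j, B ((Fin.snoc v x : Fin (r + 1) → E) i) ((Fin.snoc v x : Fin (r + 1) → E) j) = 0 := by
  set W := Submodule.span k (Set.range v)
  have hW : finrank k W = r := by simpa using finrank_span_eq_card hv
  have horth := LinearMap.BilinForm.finrank_orthogonal hB W
  have hnle : ¬ B.orthogonal W ≤ W := fun h => by
    have := Submodule.finrank_mono h
    omega
  obtain ⟨x, hx, hxW⟩ := SetLike.not_le_iff_exists.mp hnle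
  have hvx : ∀ i, B (v i) x = 0 := fun i => hx _ (Submodule.subset_span ⟨i, rfl⟩)
  refine ⟨x, hv.finSnoc hxW, fun i j => ?_⟩
  induction i using Fin.lastCases <;> induction j using Fin.lastCases <;>
    simp [hvx, hiso, hA.self_eq_zero, ← hA.neg_eq _ x]

/-- A linearly independent family with isotropic span extends to one of half the dimension. -/
theorem exists_isotropic_extension {B : LinearMap.BilinForm k E} (hB : B.Nondegenerate)
    (hA : B.IsAlt) {n r : ℕ} (hE : finrank k E = 2 * n) (hr : r ≤ n) (v : Fin r → E)
    (hv : LinearIndependent k v) (hiso : ∀ i j, B (v i) (v j) = 0) :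
    ∃ w : Fin n → E, LinearIndependent k w ∧ (∀ i j, B (w i) (w j) = 0) ∧
      ∀ i, w (Fin.castLE hr i) = v i := by
  suffices H : ∀ m (hrm : r ≤ m), m ≤ n → ∃ w : Fin m → E, LinearIndependent k w ∧
      (∀ i j, B (w i) (w j) = 0) ∧ ∀ i, w (Fin.castLE hrm i) = v i from H n hr le_rfl
  intro m hrm
  induction m, hrm using Nat.le_induction with
  | base => exact fun _ => ⟨v, hv, hiso, fun _ => rfl⟩
  | succ m hrm ih =>
    intro hm
    obtain ⟨w, hw, hwiso, hwv⟩ := ih (by omega)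
    obtain ⟨x, hx, hxiso⟩ := exists_isotropic_snoc hB hA hE hm w hw hwiso
    refine ⟨_, hx, hxiso, fun i => ?_⟩
    rw [← hwv i]
    exact Fin.snoc_castSucc (α := fun _ => E) x w (Fin.castLE hrm i)

/-- A linearly independent isotropic family has a dual family, itself isotropic. -/
theorem exists_isotropic_dual {B : LinearMap.BilinForm k E} (hB : B.Nondegenerate)
    (hA : B.IsAlt) {n : ℕ} (v : Fin n → E)
    (hv : LinearIndependent k v) (hiso : ∀ i j, B (v i) (v j) = 0) :
    ∃ w : Fin n → E, (∀ i j, B (v i) (w j) = if i = j then 1 else 0) ∧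
      ∀ i j, B (w i) (w j) = 0 := by
  have hdual : ∀ j, ∃ m : E, ∀ i, B (v i) m = if i = j then 1 else 0 := by
    intro j
    obtain ⟨f, hf⟩ := LinearMap.exists_extend ((Basis.span hv).coord j)
    refine ⟨-(B.toDual hB).symm f, fun i => ?_⟩
    rw [map_neg, hA.neg_eq, LinearMap.BilinForm.apply_toDual_symm_apply]
    have h := LinearMap.congr_fun hf (Basis.span hv i)
    simpa [Basis.span_apply, Finsupp.single_apply] using h
  choose m hm using hdual
  have hm' : ∀ i j, B (m j) (v i) = if i = j then -1 else 0 := fun i j => by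
    rw [← hA.neg_eq, hm]; split_ifs <;> simp
  let c : Fin n → Fin n → k := fun i j => if i < j then B (m i) (m j) else 0
  refine ⟨fun j => m j + ∑ i, c i j • v i, fun i j => ?_, fun i j => ?_⟩
  · simp [hm, hiso]
  · have hc : B (m i) (m j) + c j i - c i j = 0 := by
      rcases lt_trichotomy i j with h | rfl | h
      · simp [c, h, h.not_gt]
      · simp [hA.self_eq_zero]
      · simp [c, h, h.not_gt, ← hA.neg_eq (m j) (m i)]
    simp [hm, hm', hiso, LinearMap.sum_apply]
    linear_combination hc

end SymplecticBasis

/-- The standard symplectic form as a bilinear form. -/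
noncomputable def stdSymplecticBilin (k : Type*) [Field k] (n : ℕ) :
    LinearMap.BilinForm k (Fin n ⊕ Fin n → k) :=
  Matrix.toBilin' (Jmat k n)

section StdSymplecticBilin

variable {k : Type*} [Field k] {n : ℕ}

theorem stdSymplecticBilin_apply (v w : Fin n ⊕ Fin n → k) :
    stdSymplecticBilin k n v w = stdSymplecticForm n v w :=
  Matrix.toBilin'_apply' _ _ _

theorem stdSymplecticBilin_single (i j : Fin n ⊕ Fin n) :
    stdSymplecticBilin k n (Pi.single i 1) (Pi.single j 1) = Jmat k n i j :=
  Matrix.toBilin'_single _ _ _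

theorem stdSymplecticBilin_nondegenerate : (stdSymplecticBilin k n).Nondegenerate := by
  refine LinearMap.BilinForm.nondegenerate_toBilin'_of_det_ne_zero' _ ?_
  have h : Jmat k n = -Matrix.J (Fin n) k := by simp [Jmat, Matrix.J, Matrix.fromBlocks_neg]
  rw [h, Matrix.det_neg]
  exact mul_ne_zero (pow_ne_zero _ (by simp)) (Matrix.isUnit_det_J (Fin n) k).ne_zero

theorem stdSymplecticBilin_isAlt : (stdSymplecticBilin k n).IsAlt := by
  intro v
  rw [stdSymplecticBilin_apply]
  simp [stdSymplecticForm, Jmat, dotProduct, Matrix.mulVec, Fintype.sum_sum_type,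
    Matrix.one_apply, mul_comm]

end StdSymplecticBilin

theorem blockIAB_zero {k : Type*} [Field k] {r n : ℕ} (hr : r ≤ n) (i : Fin r) :
    blockIAB (0 : Matrix (Fin r) (Fin r) k) (0 : Matrix (Fin r) (Fin (n - r)) k) i =
      Pi.single (Sum.inl (Fin.castLE hr i)) 1 := by
  ext (j | j)
  · simp [blockIAB, Pi.single_apply, Fin.ext_iff]
  · simp [blockIAB]

/-- Every isotropic subspace `V ⊆ k^{2n}` of dimension `r` can be moved by a
linear symplectomorphism `U` of `(k^{2n}, ω_n)` to the row space of a block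
matrix `[I_r 0 | A B]` with `A` symmetric. -/
theorem isotropic_normal_form {k : Type*} [Field k] (n r : ℕ)
    (V : Submodule k (Fin n ⊕ Fin n → k))
    (hV : IsIsotropic (stdSymplecticForm n) V)
    (hdim : Module.finrank k V = r) :
    ∃ U : (Fin n ⊕ Fin n → k) ≃ₗ[k] (Fin n ⊕ Fin n → k),
      (∀ v w, stdSymplecticForm n (U v) (U w) = stdSymplecticForm n v w) ∧
      ∃ (A : Matrix (Fin r) (Fin r) k) (B : Matrix (Fin r) (Fin (n - r)) k),
        A = Aᵀ ∧
        Submodule.map U.toLinearMap V =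
          Submodule.span k (Set.range fun i : Fin r => blockIAB A B i) := by
  set B := stdSymplecticBilin k n with hBdef
  have hB : B.Nondegenerate := stdSymplecticBilin_nondegenerate
  have hA : B.IsAlt := stdSymplecticBilin_isAlt
  have hE : Module.finrank k (Fin n ⊕ Fin n → k) = 2 * n := by simp [two_mul]
  have hVB : V ≤ B.orthogonal V := fun x hx y hy =>
    (stdSymplecticBilin_apply y x).trans (hV hy x hx)
  have hr : r ≤ n := by
    have h₁ := LinearMap.BilinForm.finrank_orthogonal hB V
    have h₂ := Submodule.finrank_mono hVB
    have h₃ := Submodule.finrank_le V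
    omega
  let b := Module.finBasisOfFinrankEq k V hdim
  obtain ⟨v, hv, hviso, hvb⟩ := exists_isotropic_extension hB hA hE hr (fun i => (b i : _))
    (b.linearIndependent.map' V.subtype V.ker_subtype) (fun i j => hVB (b j).2 _ (b i).2)
  obtain ⟨w, hvw, hwiso⟩ := exists_isotropic_dual hB hA v hv hviso
  have hwv : ∀ i j, B (w i) (v j) = if i = j then -1 else 0 := fun i j => by
    rw [← hA.neg_eq, hvw]
    simp only [eq_comm (a := j)]
    split_ifs <;> simp
  let T : (Fin n ⊕ Fin n → k) →ₗ[k] (Fin n ⊕ Fin n → k) :=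
    Fintype.linearCombination k (Sum.elim v w)
  have hT : ∀ i, T (Pi.single i 1) = Sum.elim v w i := fun i => by
    simp [T, Fintype.linearCombination_apply_single]
  have hTB : B.comp T T = B := by
    refine LinearMap.BilinForm.ext_basis (Pi.basisFun k (Fin n ⊕ Fin n)) fun i j => ?_
    simp only [Pi.basisFun_apply, LinearMap.BilinForm.comp_apply, hT]
    rw [hBdef, stdSymplecticBilin_single, ← hBdef]
    rcases i with i | i <;> rcases j with j | j <;>
      simp [hviso, hwiso, hvw, hwv, Jmat, Matrix.one_apply]
    split_ifs <;> simp
  have hTB' : ∀ x y, B (T x) (T y) = B x y := fun x y => LinearMap.BilinForm.congr_fun hTB x y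
  have hTinj : Function.Injective T := by
    refine (injective_iff_map_eq_zero T).mpr fun x hx => hB.1 x fun y => ?_
    rw [← hTB', hx, map_zero, LinearMap.zero_apply]
  let e := LinearEquiv.ofInjectiveEndo T hTinj
  have he : ∀ x, e x = T x := fun _ => rfl
  refine ⟨e.symm, fun x y => ?_, 0, 0, by simp, ?_⟩
  · rw [← stdSymplecticBilin_apply, ← stdSymplecticBilin_apply, ← hBdef, ← hTB', ← he, ← he,
      e.apply_symm_apply, e.apply_symm_apply]
  · have hVspan : V = Submodule.span k (Set.range fun i => (b i : Fin n ⊕ Fin n → k)) := by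
      have h := congrArg (Submodule.map V.subtype) b.span_eq
      rw [Submodule.map_span, Submodule.map_top, Submodule.range_subtype, ← Set.range_comp] at h
      exact h.symm
    rw [hVspan, Submodule.map_span, ← Set.range_comp]
    congr 2
    ext1 i
    rw [blockIAB_zero hr]
    refine (e.symm_apply_eq).mpr ?_
    rw [he, hT, Sum.elim_inl, hvb]
end

section
/- Let k be a field, m, n ∈ ℕ, and let L be a Lagrangian subspace of (k^{2m} × k^{2n}, Ω_{m,n}). Then the image of L, namely {v ∈ k^{2n} : ∃ u ∈ k^{2m}, (u,v) ∈ L}, is a coisotropic subspace of (k^{2n}, ω_n). -/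
open Matrix

/-- Points of `k^{2n} = k^n × k^n`, written as pairs `(z, x)` of a Z-grading
and an X-grading. -/
abbrev PVec (k : Type*) (n : ℕ) := (Fin n → k) × (Fin n → k)

/-- The standard symplectic form on `k^{2n}`:
`ω_n((z,x),(z',x')) = z·x' − x·z'`. -/
def stdForm {k : Type*} [Field k] (n : ℕ) (v w : PVec k n) : k :=
  v.1 ⬝ᵥ w.2 - v.2 ⬝ᵥ w.1

/-- The twisted symplectic form on `k^{2m} × k^{2n}`:
`Ω_{m,n}((u,v),(u',v')) = ω_n(v,v') − ω_m(u,u')`. -/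
def twForm {k : Type*} [Field k] (m n : ℕ) (p q : PVec k m × PVec k n) : k :=
  stdForm n p.2 q.2 - stdForm m p.1 q.1

/-- A submodule is coisotropic when it contains its symplectic complement. -/
def IsCoisotropic {k X : Type*} [Field k] [AddCommGroup X] [Module k X]
    (ω : X → X → k) (U : Submodule k X) : Prop :=
  sympComplSet ω (U : Set X) ⊆ (U : Set X)

/-- A submodule is Lagrangian when it equals its symplectic complement. -/
def IsLagrangian {k X : Type*} [Field k] [AddCommGroup X] [Module k X]
    (ω : X → X → k) (U : Submodule k X) : Prop :=
  (U : Set X) = sympComplSet ω (U : Set X)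

/-- The image of a Lagrangian relation is a coisotropic subspace. -/
theorem image_of_lagrangian_isCoisotropic {k : Type*} [Field k] (m n : ℕ)
    (L : Submodule k (PVec k m × PVec k n))
    (hL : IsLagrangian (twForm m n) L) :
    IsCoisotropic (stdForm n)
      (Submodule.map (LinearMap.snd k (PVec k m) (PVec k n)) L) := by
  intro v hv
  have hmem : ((0, v) : PVec k m × PVec k n) ∈ (L : Set (PVec k m × PVec k n)) := by
    rw [hL]
    intro q hq
    have hvq : stdForm n v q.2 = 0 := hv q.2 ⟨q, hq, rfl⟩
    have hzero : stdForm m 0 q.1 = 0 := by simp [stdForm]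
    simp [twForm, hvq, hzero]
  exact ⟨(0, v), hmem, rfl⟩
end

section
/- Lagrangian relations are closed under relational composition: let k be a field and a, b, c ∈ ℕ. If L₁ is a Lagrangian subspace of (k^{2a} × k^{2b}, Ω_{a,b}) and L₂ is a Lagrangian subspace of (k^{2b} × k^{2c}, Ω_{b,c}), then the relational composite L₂ ∘ L₁ := {(u,w) : ∃ v ∈ k^{2b}, (u,v) ∈ L₁ and (v,w) ∈ L₂} is a Lagrangian subspace of (k^{2a} × k^{2c}, Ω_{a,c}). (This is the well-definedness of composition in the prop of Lagrangian relations Lag Rel_k.) -/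
open Matrix

/-- The linear functional `ω_n(v, ·)`. -/
def stdFormRight {k : Type*} [Field k] (n : ℕ) (v : PVec k n) : PVec k n →ₗ[k] k where
  toFun := stdForm n v
  map_add' x y := by
    simp only [stdForm, Prod.fst_add, Prod.snd_add, dotProduct_add]
    ring
  map_smul' r x := by
    simp only [stdForm, Prod.smul_fst, Prod.smul_snd, dotProduct_smul, smul_eq_mul,
      RingHom.id_apply]
    ring

@[simp]
theorem stdFormRight_apply {k : Type*} [Field k] {n : ℕ} (v w : PVec k n) :
    stdFormRight n v w = stdForm n v w :=
  rfl

theorem stdForm_neg_left {k : Type*} [Field k] {n : ℕ} (v w : PVec k n) :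
    stdForm n (-v) w = -stdForm n v w := by
  simp only [stdForm, Prod.fst_neg, Prod.snd_neg, neg_dotProduct]
  ring

theorem stdForm_zero_right {k : Type*} [Field k] {n : ℕ} (v : PVec k n) : stdForm n v 0 = 0 :=
  map_zero (stdFormRight n v)

theorem stdForm_neg_right {k : Type*} [Field k] {n : ℕ} (v w : PVec k n) :
    stdForm n v (-w) = -stdForm n v w :=
  map_neg (stdFormRight n v) w

/-- The standard symplectic form is nondegenerate: every functional is `ω_n(v, ·)` for some `v`. -/
theorem exists_stdFormRight_eq {k : Type*} [Field k] {n : ℕ} (ψ : PVec k n →ₗ[k] k) :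
    ∃ v, stdFormRight n v = ψ := by
  refine ⟨(fun i ↦ ψ (0, Pi.single i 1), fun i ↦ -ψ (Pi.single i 1, 0)), ?_⟩
  ext i <;> simp [stdForm]

/-- The composite `L₂ ∘ L₁` of two linear relations. -/
def relComp {k U V W : Type*} [Field k] [AddCommGroup U] [Module k U] [AddCommGroup V]
    [Module k V] [AddCommGroup W] [Module k W] (L₁ : Submodule k (U × V))
    (L₂ : Submodule k (V × W)) : Submodule k (U × W) where
  carrier := {p | ∃ v : V, (p.1, v) ∈ L₁ ∧ (v, p.2) ∈ L₂}
  add_mem' := by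
    rintro p q ⟨v, hv₁, hv₂⟩ ⟨v', hv'₁, hv'₂⟩
    exact ⟨v + v', L₁.add_mem hv₁ hv'₁, L₂.add_mem hv₂ hv'₂⟩
  zero_mem' := ⟨0, L₁.zero_mem, L₂.zero_mem⟩
  smul_mem' := by
    rintro r p ⟨v, hv₁, hv₂⟩
    exact ⟨r • v, L₁.smul_mem r hv₁, L₂.smul_mem r hv₂⟩

theorem IsLagrangian.mem_iff {k X : Type*} [Field k] [AddCommGroup X] [Module k X]
    {ω : X → X → k} {U : Submodule k X} (h : IsLagrangian ω U) {x : X} :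
    x ∈ U ↔ ∀ u ∈ U, ω x u = 0 :=
  Set.ext_iff.mp h x

theorem IsLagrangian.isIsotropic_relComp {k : Type*} [Field k] {a b c : ℕ}
    {L₁ : Submodule k (PVec k a × PVec k b)} {L₂ : Submodule k (PVec k b × PVec k c)}
    (h₁ : IsLagrangian (twForm a b) L₁) (h₂ : IsLagrangian (twForm b c) L₂) :
    IsIsotropic (twForm a c) (relComp L₁ L₂) := by
  rintro p ⟨v, hv₁, hv₂⟩ q ⟨v', hv'₁, hv'₂⟩
  have e₁ := h₁.mem_iff.mp hv₁ _ hv'₁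
  have e₂ := h₂.mem_iff.mp hv₂ _ hv'₂
  simp only [twForm] at e₁ e₂ ⊢
  linear_combination e₁ + e₂

/-- A functional on `L₁ × L₂` killing all composable pairs factors through the difference of the
middle coordinates; the vector representing it is the required intermediate point. -/
theorem IsLagrangian.isCoisotropic_relComp {k : Type*} [Field k] {a b c : ℕ}
    {L₁ : Submodule k (PVec k a × PVec k b)} {L₂ : Submodule k (PVec k b × PVec k c)}
    (h₁ : IsLagrangian (twForm a b) L₁) (h₂ : IsLagrangian (twForm b c) L₂) :
    IsCoisotropic (twForm a c) (relComp L₁ L₂) := by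
  rintro ⟨u, w⟩ hp
  let D : (L₁ × L₂) →ₗ[k] PVec k b :=
    (LinearMap.snd k _ _ ∘ₗ L₁.subtype).coprod (-(LinearMap.fst k _ _ ∘ₗ L₂.subtype))
  let φ : (L₁ × L₂) →ₗ[k] k :=
    (-(stdFormRight a u ∘ₗ LinearMap.fst k _ _ ∘ₗ L₁.subtype)).coprod
      (stdFormRight c w ∘ₗ LinearMap.snd k _ _ ∘ₗ L₂.subtype)
  have hφ : φ ∈ LinearMap.range D.dualMap := by
    rw [LinearMap.range_dualMap_eq_dualAnnihilator_ker, Submodule.mem_dualAnnihilator]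
    rintro ⟨⟨⟨u', v₁⟩, hv₁⟩, ⟨⟨v₂, w'⟩, hv₂⟩⟩ hD
    have hv : v₁ = v₂ := by
      simpa [D, ← sub_eq_add_neg, sub_eq_zero] using hD
    subst hv
    have e : twForm a c (u, w) (u', w') = 0 := hp (u', w') ⟨v₁, hv₁, hv₂⟩
    simp only [twForm] at e
    simp only [φ, LinearMap.coprod_apply, LinearMap.neg_apply, LinearMap.comp_apply,
      Submodule.subtype_apply, LinearMap.fst_apply, LinearMap.snd_apply, stdFormRight_apply]
    linear_combination e
  obtain ⟨ψ, hψ⟩ := hφ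
  obtain ⟨s, rfl⟩ := exists_stdFormRight_eq ψ
  refine ⟨-s, h₁.mem_iff.mpr fun q hq ↦ ?_, h₂.mem_iff.mpr fun q hq ↦ ?_⟩
  · have e : stdForm b s q.2 = -stdForm a u q.1 := by
      simpa [D, φ, stdForm_zero_right] using LinearMap.congr_fun hψ (⟨q, hq⟩, 0)
    simp only [twForm, stdForm_neg_left]
    linear_combination -e
  · have e : -stdForm b s q.1 = stdForm c w q.2 := by
      simpa [D, φ, stdForm_zero_right, stdForm_neg_right] using LinearMap.congr_fun hψ (0, ⟨q, hq⟩)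
    simp only [twForm, stdForm_neg_left]
    linear_combination -e

/-- Lagrangian relations are closed under relational composition: the composite
of two Lagrangian relations is again a Lagrangian subspace. -/
theorem lagrangian_relations_comp {k : Type*} [Field k] (a b c : ℕ)
    (L₁ : Submodule k (PVec k a × PVec k b))
    (L₂ : Submodule k (PVec k b × PVec k c))
    (h₁ : IsLagrangian (twForm a b) L₁)
    (h₂ : IsLagrangian (twForm b c) L₂) :
    ∃ L : Submodule k (PVec k a × PVec k c),
      (L : Set (PVec k a × PVec k c)) =
        {p | ∃ v : PVec k b, (p.1, v) ∈ L₁ ∧ (v, p.2) ∈ L₂} ∧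
      IsLagrangian (twForm a c) L := by
  exact ⟨relComp L₁ L₂, rfl,
    (h₁.isIsotropic_relComp h₂).antisymm (h₁.isCoisotropic_relComp h₂)⟩
end

section
/- Characterization of the classical subcategory (content of the theorem that the full subcategory of split Z-projectors is isomorphic to Aff Rel_k): let k be a field and a, b, c ∈ ℕ, and define the Z-projector relation P_a := {((z,x),(z',x)) : z, z', x ∈ k^a} ⊆ k^{2a} × k^{2a}. For an affine relation R₀ ⊆ k^a × k^b define Φ(R₀) := {((z,x),(z',x')) ∈ k^{2a} × k^{2b} : (x,x') ∈ R₀}. Then: (i) for every nonempty affine relation R₀, Φ(R₀) is an affine coisotropic relation from k^{2a} to k^{2b} satisfying P_b ∘ Φ(R₀) ∘ P_a = Φ(R₀); (ii) conversely, every relation R ⊆ k^{2a} × k^{2b} that is an affine subspace and satisfies P_b ∘ R ∘ P_a = R equals Φ(R₀) for a unique affine relation R₀ ⊆ k^a × k^b, namely R₀ = {(x,x') : ∃ z, z', ((z,x),(z',x')) ∈ R}; and (iii) Φ preserves relational composition: Φ(S₀ ∘ R₀) = Φ(S₀) ∘ Φ(R₀) for all affine relations R₀ ⊆ k^a × k^b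 and S₀ ⊆ k^b × k^c. -/
open Matrix

/-- Relational composition of set relations (first `R`, then `S`), i.e. `S ∘ R`. -/
def scomp {A B C : Type*} (R : Set (A × B)) (S : Set (B × C)) : Set (A × C) :=
  {p | ∃ v : B, (p.1, v) ∈ R ∧ (v, p.2) ∈ S}

/-- A subset of a `k`-vector space is an affine subspace when it is either
empty or a coset `a + D` of a linear subspace `D`. -/
def IsAffineSubspace (k : Type*) {X : Type*} [Field k] [AddCommGroup X]
    [Module k X] (S : Set X) : Prop :=
  S = ∅ ∨ ∃ (a : X) (D : Submodule k X), S = (fun d => a + d) '' (D : Set X)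

/-- The Z-projector relation `P_a = {((z,x),(z',x)) : z, z', x ∈ k^a}`. -/
def Pz (k : Type*) [Field k] (a : ℕ) : Set (PVec k a × PVec k a) :=
  {p | p.1.2 = p.2.2}

/-- `Φ(R₀) = {((z,x),(z',x')) : (x,x') ∈ R₀}`. -/
def Phi (k : Type*) [Field k] (a b : ℕ)
    (R₀ : Set ((Fin a → k) × (Fin b → k))) : Set (PVec k a × PVec k b) :=
  {p | (p.1.2, p.2.2) ∈ R₀}

/-- The linear projection of `k^{2a} × k^{2b}` onto its X-gradings. -/
def xProj (k : Type*) [Field k] (a b : ℕ) :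
    (PVec k a × PVec k b) →ₗ[k] ((Fin a → k) × (Fin b → k)) :=
  (LinearMap.snd k (Fin a → k) (Fin a → k)).prodMap (LinearMap.snd k (Fin b → k) (Fin b → k))

theorem xProj_apply {k : Type*} [Field k] {a b : ℕ} (p : PVec k a × PVec k b) :
    xProj k a b p = (p.1.2, p.2.2) := rfl

/-- The preimage of a coset under a linear map is a coset of the preimage of its direction. -/
theorem LinearMap.preimage_coset {k X Y : Type*} [Field k] [AddCommGroup X] [Module k X]
    [AddCommGroup Y] [Module k Y] (f : X →ₗ[k] Y) (p : X) (D : Submodule k Y) :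
    f ⁻¹' ((fun d => f p + d) '' (D : Set Y)) = (fun d => p + d) '' (D.comap f : Set X) := by
  ext x
  constructor
  · rintro ⟨d, hd, hx⟩
    refine ⟨x - p, ?_, add_sub_cancel p x⟩
    have h : f (x - p) = d := by rw [map_sub, ← hx]; exact add_sub_cancel_left _ _
    simpa [h] using hd
  · rintro ⟨d, hd, rfl⟩
    exact ⟨f d, hd, (map_add f p d).symm⟩

/-- The image of an affine subspace under a linear map is an affine subspace. -/
theorem IsAffineSubspace.image {k X Y : Type*} [Field k] [AddCommGroup X] [Module k X]
    [AddCommGroup Y] [Module k Y] (f : X →ₗ[k] Y) {S : Set X} (hS : IsAffineSubspace k S) :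
    IsAffineSubspace k (f '' S) := by
  rcases hS with rfl | ⟨p, D, rfl⟩
  · exact Or.inl (Set.image_empty f)
  · refine Or.inr ⟨f p, D.map f, ?_⟩
    simp only [Submodule.map_coe, Set.image_image, map_add]

/-- A subspace pulled back from the X-gradings is coisotropic. -/
theorem isCoisotropic_comap_xProj {k : Type*} [Field k] {a b : ℕ}
    (D : Submodule k ((Fin a → k) × (Fin b → k))) :
    IsCoisotropic (twForm a b) (D.comap (xProj k a b)) := by
  intro p hp
  have key : ∀ (z : Fin a → k) (z' : Fin b → k), twForm a b p ((z, 0), (z', 0)) = 0 :=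
    fun z z' => hp _ (D.zero_mem : xProj k a b ((z, 0), (z', 0)) ∈ D)
  have h₁ : p.1.2 = 0 := dotProduct_eq_zero _ fun z => by
    simpa [twForm, stdForm] using key z 0
  have h₂ : p.2.2 = 0 := dotProduct_eq_zero _ fun z' => by
    simpa [twForm, stdForm] using key 0 z'
  change xProj k a b p ∈ D
  rw [xProj_apply, h₁, h₂]
  exact D.zero_mem

/-- Composing with the Z-projectors on both sides saturates a relation along the Z-gradings. -/
theorem scomp_Pz_Pz {k : Type*} [Field k] {a b : ℕ} (R : Set (PVec k a × PVec k b)) :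
    scomp (scomp (Pz k a) R) (Pz k b) =
      Phi k a b {q | ∃ z z', ((z, q.1), (z', q.2)) ∈ R} := by
  ext ⟨⟨z, x⟩, ⟨z', x'⟩⟩
  constructor
  · rintro ⟨⟨w', y'⟩, ⟨⟨w, y⟩, h₁, h₂⟩, h₃⟩
    obtain rfl : x = y := h₁
    obtain rfl : y' = x' := h₃
    exact ⟨w, w', h₂⟩
  · rintro ⟨w, w', h⟩
    exact ⟨(w', x'), ⟨(w, x), rfl, h⟩, rfl⟩

/-- The marginal of `Phi R₀` on the X-gradings is `R₀`. -/
theorem marginal_Phi {k : Type*} [Field k] {a b : ℕ} (R₀ : Set ((Fin a → k) × (Fin b → k))) :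
    {q : (Fin a → k) × (Fin b → k) | ∃ z z', ((z, q.1), (z', q.2)) ∈ Phi k a b R₀} = R₀ :=
  Set.ext fun _ => ⟨fun ⟨_, _, h⟩ => h, fun h => ⟨0, 0, h⟩⟩

/-- The marginal of a relation on the X-gradings is its image under `xProj`. -/
theorem marginal_eq_image_xProj {k : Type*} [Field k] {a b : ℕ}
    (R : Set (PVec k a × PVec k b)) :
    {q : (Fin a → k) × (Fin b → k) | ∃ z z', ((z, q.1), (z', q.2)) ∈ R} = xProj k a b '' R := by
  ext q
  constructor
  · rintro ⟨z, z', h⟩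
    exact ⟨_, h, rfl⟩
  · rintro ⟨p, h, rfl⟩
    exact ⟨p.1.1, p.2.1, h⟩

/-- `Phi` preserves relational composition. -/
theorem Phi_scomp {k : Type*} [Field k] {a b c : ℕ} (R₀ : Set ((Fin a → k) × (Fin b → k)))
    (S₀ : Set ((Fin b → k) × (Fin c → k))) :
    Phi k a c (scomp R₀ S₀) = scomp (Phi k a b R₀) (Phi k b c S₀) :=
  Set.ext fun _ => ⟨fun ⟨x, h₁, h₂⟩ => ⟨(0, x), h₁, h₂⟩, fun ⟨v, h₁, h₂⟩ => ⟨v.2, h₁, h₂⟩⟩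

/-- Characterization of the classical subcategory: `Φ` sends nonempty affine
relations to affine coisotropic relations fixed by pre- and post-composition
with the Z-projectors, every affine relation fixed by the Z-projectors is
`Φ(R₀)` for a unique affine `R₀` (namely the marginal), and `Φ` preserves
relational composition. -/
theorem classical_subcategory_char {k : Type*} [Field k] (a b c : ℕ) :
    (∀ R₀ : Set ((Fin a → k) × (Fin b → k)),
      (∃ (r : (Fin a → k) × (Fin b → k))
          (D₀ : Submodule k ((Fin a → k) × (Fin b → k))),
        R₀ = (fun d => r + d) '' (D₀ : Set ((Fin a → k) × (Fin b → k)))) →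
      ((∃ (p : PVec k a × PVec k b) (D : Submodule k (PVec k a × PVec k b)),
          Phi k a b R₀ = (fun d => p + d) '' (D : Set (PVec k a × PVec k b)) ∧
          IsCoisotropic (twForm a b) D) ∧
        scomp (scomp (Pz k a) (Phi k a b R₀)) (Pz k b) = Phi k a b R₀)) ∧
    (∀ R : Set (PVec k a × PVec k b),
      IsAffineSubspace k R →
      scomp (scomp (Pz k a) R) (Pz k b) = R →
      (IsAffineSubspace k
          {q : (Fin a → k) × (Fin b → k) |
            ∃ z z', ((z, q.1), (z', q.2)) ∈ R} ∧
        R = Phi k a b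
          {q : (Fin a → k) × (Fin b → k) |
            ∃ z z', ((z, q.1), (z', q.2)) ∈ R} ∧
        ∀ R₀ : Set ((Fin a → k) × (Fin b → k)),
          IsAffineSubspace k R₀ → R = Phi k a b R₀ →
            R₀ = {q : (Fin a → k) × (Fin b → k) |
              ∃ z z', ((z, q.1), (z', q.2)) ∈ R})) ∧
    (∀ (R₀ : Set ((Fin a → k) × (Fin b → k)))
      (S₀ : Set ((Fin b → k) × (Fin c → k))),
      IsAffineSubspace k R₀ → IsAffineSubspace k S₀ →
        Phi k a c (scomp R₀ S₀) = scomp (Phi k a b R₀) (Phi k b c S₀)) := by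
  refine ⟨?_, ?_, fun R₀ S₀ _ _ => Phi_scomp R₀ S₀⟩
  · rintro R₀ ⟨r, D₀, rfl⟩
    refine ⟨⟨((0, r.1), (0, r.2)), D₀.comap (xProj k a b), ?_, isCoisotropic_comap_xProj D₀⟩, ?_⟩
    · exact (xProj k a b).preimage_coset ((0, r.1), (0, r.2)) D₀
    · rw [scomp_Pz_Pz, marginal_Phi]
  · intro R hR hfix
    refine ⟨?_, ?_, ?_⟩
    · rw [marginal_eq_image_xProj]
      exact hR.image _
    · rw [← scomp_Pz_Pz, hfix]
    · rintro R₀ - rfl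
      exact (marginal_Phi R₀).symm
end
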